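/- For μ → ∞, if X_μ is a Poisson random variable with parameter μ, then E[log(X_μ!)] = μ log μ − μ + (1/2)·log(2πeμ) + O(1/μ). -/

import Mathlib

open Filter Asymptotics

/-- Poisson pmf with parameter `μ`. -/
noncomputable def poissonPMF (μ : ℝ) (k : ℕ) : ℝ :=
  Real.exp (-μ) * μ ^ k / (Nat.factorial k)

/-- Robbins' upper bound for the Stirling sequence. -/
lemma log_stirlingSeq_succ_le (n : ℕ) :
    Real.log (Stirling.stirlingSeq (n + 1)) ≤ Real.log Real.pi / 2 + 1 / (12 * (n + 1)) := by
  set f : ℕ → ℝ := fun n => Real.log (Stirling.stirlingSeq (n + 1)) - 1 / 12 * (1 / ((n : ℝ) + 1))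
    with hf
  have hmono : Monotone f := monotone_nat_of_le_succ fun n => by
    have h := Stirling.log_stirlingSeq_sdiff_le (n + 1)
    have e : (1 : ℝ) / (12 * (n + 1 : ℕ) * ((n + 1 : ℕ) + 1))
        = 1 / 12 * (1 / ((n : ℝ) + 1)) - 1 / 12 * (1 / ((n : ℝ) + 1 + 1)) := by
      push_cast
      field_simp
      ring
    rw [e] at h
    simp only [hf]
    push_cast
    linarith
  have hlim : Tendsto f atTop (nhds (Real.log √Real.pi - 1 / 12 * 0)) := by
    refine Tendsto.sub ?_ (tendsto_one_div_add_atTop_nhds_zero_nat.const_mul _)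
    exact (Stirling.tendsto_stirlingSeq_sqrt_pi.comp (tendsto_add_atTop_nat 1)).log (by positivity)
  have h := hmono.ge_of_tendsto hlim n
  rw [Real.log_sqrt Real.pi_pos.le] at h
  have e : (1 : ℝ) / (12 * (n + 1)) = 1 / 12 * (1 / ((n : ℝ) + 1)) := by field_simp
  rw [e]
  simp only [hf] at h
  linarith

lemma log_factorial_eq_log_factorial_succ_sub (k : ℕ) :
    Real.log (Nat.factorial k) = Real.log (Nat.factorial (k + 1)) - Real.log (k + 1) := by
  rw [Nat.factorial_succ]
  push_cast
  rw [Real.log_mul (by positivity) (by positivity)]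
  ring

lemma le_log_factorial (k : ℕ) :
    (k + 1 / 2) * Real.log (k + 1) - (k + 1) + Real.log (2 * Real.pi) / 2
      ≤ Real.log (Nat.factorial k) := by
  have h := Stirling.le_log_factorial_stirling (n := k + 1) (by simp)
  rw [log_factorial_eq_log_factorial_succ_sub]
  push_cast at h
  linarith

lemma log_factorial_le (k : ℕ) :
    Real.log (Nat.factorial k) ≤ (k + 1 / 2) * Real.log (k + 1) - (k + 1)
      + Real.log (2 * Real.pi) / 2 + 1 / (12 * (k + 1)) := by
  have h := log_stirlingSeq_succ_le k
  rw [Stirling.log_stirlingSeq_formula] at h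
  push_cast at h
  rw [Real.log_mul two_ne_zero (by positivity), Real.log_div (by positivity) (Real.exp_ne_zero _),
    Real.log_exp] at h
  rw [log_factorial_eq_log_factorial_succ_sub, Real.log_mul two_ne_zero Real.pi_ne_zero]
  linarith

/-- A function on `(0, ∞)` whose derivative has the sign of `x - 1` is minimal at `1`. -/
lemma apply_one_le_of_hasDerivAt {f q : ℝ → ℝ}
    (hf : ∀ x, 0 < x → HasDerivAt f ((x - 1) ^ 3 * q x) x) (hq : ∀ x, 0 < x → 0 ≤ q x)
    {s : ℝ} (hs : 0 < s) : f 1 ≤ f s := by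
  rcases lt_trichotomy s 1 with h | rfl | h
  · obtain ⟨c, hc, e⟩ := exists_hasDerivAt_eq_slope f _ h
      (fun x hx => (hf x (hs.trans_le hx.1)).continuousAt.continuousWithinAt)
      (fun x hx => hf x (hs.trans hx.1))
    rw [eq_div_iff (by linarith)] at e
    have h3 : 0 ≤ (1 - c) ^ 3 := pow_nonneg (by linarith [hc.2]) 3
    have h4 := mul_nonneg (mul_nonneg h3 (hq c (hs.trans hc.1))) (sub_nonneg.2 h.le)
    linarith
  · exact le_rfl
  · obtain ⟨c, hc, e⟩ := exists_hasDerivAt_eq_slope f _ h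
      (fun x hx => (hf x (one_pos.trans_le hx.1)).continuousAt.continuousWithinAt)
      (fun x hx => hf x (one_pos.trans hx.1))
    rw [eq_div_iff (by linarith)] at e
    have h3 : 0 ≤ (c - 1) ^ 3 := pow_nonneg (by linarith [hc.1]) 3
    have h4 := mul_nonneg (mul_nonneg h3 (hq c (one_pos.trans hc.1))) (sub_nonneg.2 h.le)
    linarith

lemma mul_log_le {s : ℝ} (hs : 0 < s) :
    s * Real.log s ≤ (s - 1) + (s - 1) ^ 2 / 2 - (s - 1) ^ 3 / 6 + (s - 1) ^ 4 / 3 := by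
  have h := apply_one_le_of_hasDerivAt (q := fun x => x⁻¹)
    (f := fun x => (x - 1) - (x - 1) ^ 2 / 2 + (x - 1) ^ 3 / 3 - Real.log x)
    (fun x hx => by
      have h1 := (hasDerivAt_id x).sub_const 1
      refine (((h1.sub ((h1.pow 2).div_const 2)).add ((h1.pow 3).div_const 3)).sub
        (Real.hasDerivAt_log hx.ne')).congr_deriv ?_
      simp only [id]
      field_simp
      ring)
    (fun x hx => by positivity) hs
  simp only [sub_self, Real.log_one] at h
  nlinarith

lemma le_mul_log {s : ℝ} (hs : 0 < s) :
    (s - 1) + (s - 1) ^ 2 / 2 - (s - 1) ^ 3 / 6 ≤ s * Real.log s := by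
  have h := apply_one_le_of_hasDerivAt (q := fun x => 1 / (3 * x ^ 2))
    (f := fun x => Real.log x - ((x - 1) + (x - 1) ^ 2 / 2 - (x - 1) ^ 3 / 6) / x)
    (fun x hx => by
      have h1 := (hasDerivAt_id x).sub_const 1
      refine ((Real.hasDerivAt_log hx.ne').sub
        (((h1.add ((h1.pow 2).div_const 2)).sub ((h1.pow 3).div_const 6)).div
          (hasDerivAt_id x) hx.ne')).congr_deriv ?_
      simp only [id, Pi.add_apply, Pi.sub_apply, Pi.pow_apply]
      field_simp
      ring)
    (fun x hx => by positivity) hs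
  simp only [sub_self, Real.log_one] at h
  have h2 : ((s - 1) + (s - 1) ^ 2 / 2 - (s - 1) ^ 3 / 6) / s ≤ Real.log s := by linarith
  rw [div_le_iff₀ hs] at h2
  linarith

lemma poissonPMF_nonneg {μ : ℝ} (hμ : 0 ≤ μ) (k : ℕ) : 0 ≤ poissonPMF μ k := by
  unfold poissonPMF
  positivity

lemma hasSum_poissonPMF (μ : ℝ) : HasSum (poissonPMF μ) 1 := by
  have h := (NormedSpace.expSeries_div_hasSum_exp μ).mul_left (Real.exp (-μ))
  rw [← Real.exp_eq_exp_ℝ, ← Real.exp_add, neg_add_cancel, Real.exp_zero] at h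
  refine h.congr_fun ?_
  intro k
  simp [poissonPMF, mul_div_assoc]

lemma poissonPMF_succ_mul (μ : ℝ) (k : ℕ) :
    poissonPMF μ (k + 1) * (k + 1) = μ * poissonPMF μ k := by
  unfold poissonPMF
  rw [Nat.factorial_succ]
  push_cast
  field_simp
  ring

/-- The Stein–Chen identity for the Poisson distribution. -/
lemma hasSum_poissonPMF_mul_of_succ {μ a : ℝ} {g : ℕ → ℝ}
    (h : HasSum (fun k => poissonPMF μ k * g (k + 1)) a) :
    HasSum (fun k => poissonPMF μ k * (k * g k)) (μ * a) := by
  rw [← hasSum_nat_add_iff' 1]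
  simp only [Finset.sum_range_one, Nat.cast_zero, zero_mul, mul_zero, sub_zero]
  refine (h.mul_left μ).congr_fun fun k => ?_
  rw [← mul_assoc, ← mul_assoc, ← poissonPMF_succ_mul]
  push_cast
  ring

lemma hasSum_poissonPMF_div_succ {μ : ℝ} (hμ : μ ≠ 0) :
    HasSum (fun k => poissonPMF μ k * (1 / ((k : ℝ) + 1))) ((1 - Real.exp (-μ)) / μ) := by
  have h := (hasSum_nat_add_iff' 1).2 (hasSum_poissonPMF μ)
  have h0 : poissonPMF μ 0 = Real.exp (-μ) := by simp [poissonPMF]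
  rw [Finset.sum_range_one, h0] at h
  refine (h.div_const μ).congr_fun fun k => ?_
  have := poissonPMF_succ_mul μ k
  field_simp
  linarith

/-- The expectation under the Poisson distribution of a quartic polynomial in `k + 1 - μ`,
plus a multiple of `1 / (k + 1)`. -/
lemma hasSum_poissonPMF_mul_quartic {μ : ℝ} (hμ : μ ≠ 0) (a₀ a₁ a₂ a₃ a₄ b : ℝ) :
    HasSum (fun k : ℕ => poissonPMF μ k * (a₀ + a₁ * (k + 1 - μ) + a₂ * (k + 1 - μ) ^ 2
        + a₃ * (k + 1 - μ) ^ 3 + a₄ * (k + 1 - μ) ^ 4 + b * (1 / (k + 1))))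
      (a₀ + a₁ + a₂ * (μ + 1) + a₃ * (4 * μ + 1) + a₄ * (3 * μ ^ 2 + 11 * μ + 1)
        + b * ((1 - Real.exp (-μ)) / μ)) := by
  have m0 := hasSum_poissonPMF μ
  have m1 : HasSum (fun k : ℕ => poissonPMF μ k * (k : ℝ)) μ := by
    have := hasSum_poissonPMF_mul_of_succ (μ := μ) (g := fun _ => 1) (by simpa using m0)
    simpa using this
  have m2 : HasSum (fun k : ℕ => poissonPMF μ k * (k : ℝ) ^ 2) (μ * (μ + 1)) := by
    refine (hasSum_poissonPMF_mul_of_succ (g := fun k => (k : ℝ))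
      ((m1.add m0).congr_fun fun k => ?_)).congr_fun fun k => ?_
    · push_cast; ring
    · ring
  have m3 : HasSum (fun k : ℕ => poissonPMF μ k * (k : ℝ) ^ 3)
      (μ * (μ * (μ + 1) + 2 * μ + 1)) := by
    refine (hasSum_poissonPMF_mul_of_succ (g := fun k => (k : ℝ) ^ 2)
      (((m2.add (m1.mul_left 2)).add m0).congr_fun fun k => ?_)).congr_fun fun k => ?_
    · push_cast; ring
    · ring
  have m4 : HasSum (fun k : ℕ => poissonPMF μ k * (k : ℝ) ^ 4)
      (μ * (μ * (μ * (μ + 1) + 2 * μ + 1) + 3 * (μ * (μ + 1)) + 3 * μ + 1)) := by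
    refine (hasSum_poissonPMF_mul_of_succ (g := fun k => (k : ℝ) ^ 3)
      ((((m3.add (m2.mul_left 3)).add (m1.mul_left 3)).add m0).congr_fun
        fun k => ?_)).congr_fun fun k => ?_
    · push_cast; ring
    · ring
  have h := (((((m0.mul_left (a₀ + a₁ * (1 - μ) + a₂ * (1 - μ) ^ 2 + a₃ * (1 - μ) ^ 3
      + a₄ * (1 - μ) ^ 4)).add
    (m1.mul_left (a₁ + 2 * a₂ * (1 - μ) + 3 * a₃ * (1 - μ) ^ 2 + 4 * a₄ * (1 - μ) ^ 3))).add
    (m2.mul_left (a₂ + 3 * a₃ * (1 - μ) + 6 * a₄ * (1 - μ) ^ 2))).add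
    (m3.mul_left (a₃ + 4 * a₄ * (1 - μ)))).add (m4.mul_left a₄)).add
    ((hasSum_poissonPMF_div_succ hμ).mul_left b)
  refine (congrArg (HasSum _ · _) ?_).mp (h.congr_fun fun k => ?_)
  · ring
  · ring

lemma poisson_quartic_le_log_factorial {μ : ℝ} (hμ : 0 < μ) (k : ℕ) :
    ((μ - 1 / 2) * Real.log μ - μ + Real.log (2 * Real.pi) / 2)
      + (Real.log μ - 1 / (2 * μ)) * (k + 1 - μ) + 1 / (2 * μ) * (k + 1 - μ) ^ 2
      + -(1 / (6 * μ ^ 2)) * (k + 1 - μ) ^ 3 + 0 * (k + 1 - μ) ^ 4 + 0 * (1 / (k + 1))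
      ≤ Real.log (Nat.factorial k) := by
  refine le_trans ?_ (le_log_factorial k)
  obtain ⟨s, hs⟩ : ∃ s : ℝ, s = (k + 1) / μ := ⟨_, rfl⟩
  have hs0 : 0 < s := hs ▸ by positivity
  have hk : (k : ℝ) = s * μ - 1 := by rw [hs]; field_simp; ring
  have h1 := mul_le_mul_of_nonneg_left (le_mul_log hs0) hμ.le
  have h2 := Real.log_le_sub_one_of_pos hs0
  rw [hk, sub_add_cancel, Real.log_mul hs0.ne' hμ.ne']
  have e : (1 / (2 * μ) * (s * μ - μ) ^ 2 + -(1 / (6 * μ ^ 2)) * (s * μ - μ) ^ 3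
      - 1 / (2 * μ) * (s * μ - μ)) = μ * ((s - 1) ^ 2 / 2 - (s - 1) ^ 3 / 6) - (s - 1) / 2 := by
    field_simp
    ring
  linarith

lemma log_factorial_le_poisson_quartic {μ : ℝ} (hμ : 0 < μ) (k : ℕ) :
    Real.log (Nat.factorial k) ≤
      ((μ - 1 / 2) * Real.log μ - μ + Real.log (2 * Real.pi) / 2 - 1 / 2)
      + Real.log μ * (k + 1 - μ) + 1 / (2 * μ) * (k + 1 - μ) ^ 2
      + -(1 / (6 * μ ^ 2)) * (k + 1 - μ) ^ 3 + 1 / (3 * μ ^ 3) * (k + 1 - μ) ^ 4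
      + (μ / 2 + 1 / 12) * (1 / (k + 1)) := by
  refine (log_factorial_le k).trans ?_
  obtain ⟨s, hs⟩ : ∃ s : ℝ, s = (k + 1) / μ := ⟨_, rfl⟩
  have hs0 : 0 < s := hs ▸ by positivity
  have hk : (k : ℝ) = s * μ - 1 := by rw [hs]; field_simp; ring
  have h1 := mul_le_mul_of_nonneg_left (mul_log_le hs0) hμ.le
  have h2 := Real.one_sub_inv_le_log_of_pos hs0
  rw [hk, sub_add_cancel, Real.log_mul hs0.ne' hμ.ne']
  have e : (1 / (2 * μ) * (s * μ - μ) ^ 2 + -(1 / (6 * μ ^ 2)) * (s * μ - μ) ^ 3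
      + 1 / (3 * μ ^ 3) * (s * μ - μ) ^ 4)
      = μ * ((s - 1) ^ 2 / 2 - (s - 1) ^ 3 / 6 + (s - 1) ^ 4 / 3) := by
    field_simp
    ring
  have e2 : (μ / 2 + 1 / 12) * (1 / (s * μ)) = s⁻¹ / 2 + 1 / (12 * (s * μ)) := by
    field_simp
  linarith

/-- `E[log(X_μ!)] = μ log μ - μ + (1/2) log(2πeμ) + O(1/μ)` as `μ → ∞`. -/
theorem stmt_7 :
    (fun μ : ℝ => (∑' k : ℕ, poissonPMF μ k * Real.log (Nat.factorial k)) -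
        (μ * Real.log μ - μ + (1/2) * Real.log (2 * Real.pi * Real.exp 1 * μ)))
      =O[atTop] (fun μ => 1 / μ) := by
  refine IsBigO.of_bound 6 ?_
  filter_upwards [eventually_ge_atTop 1] with μ hμ1
  have hμ : 0 < μ := one_pos.trans_le hμ1
  have hp := poissonPMF_nonneg hμ.le
  have hlow := hasSum_poissonPMF_mul_quartic hμ.ne'
    ((μ - 1 / 2) * Real.log μ - μ + Real.log (2 * Real.pi) / 2)
    (Real.log μ - 1 / (2 * μ)) (1 / (2 * μ)) (-(1 / (6 * μ ^ 2))) 0 0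
  have hupp := hasSum_poissonPMF_mul_quartic hμ.ne'
    ((μ - 1 / 2) * Real.log μ - μ + Real.log (2 * Real.pi) / 2 - 1 / 2)
    (Real.log μ) (1 / (2 * μ)) (-(1 / (6 * μ ^ 2))) (1 / (3 * μ ^ 3)) (μ / 2 + 1 / 12)
  have hle := fun k => mul_le_mul_of_nonneg_left (log_factorial_le_poisson_quartic hμ k) (hp k)
  have hsum : Summable fun k : ℕ => poissonPMF μ k * Real.log (Nat.factorial k) :=
    .of_nonneg_of_le (fun k => mul_nonneg (hp k) (Real.log_natCast_nonneg _)) hle hupp.summable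
  have hU := hasSum_le hle hsum.hasSum hupp
  have hL := hasSum_le
    (fun k => mul_le_mul_of_nonneg_left (poisson_quartic_le_log_factorial hμ k) (hp k))
    hlow hsum.hasSum
  have hlog : Real.log (2 * Real.pi * Real.exp 1 * μ)
      = Real.log (2 * Real.pi) + 1 + Real.log μ := by
    rw [Real.log_mul (by positivity) hμ.ne', Real.log_mul (by positivity) (Real.exp_ne_zero _),
      Real.log_exp]
  have hi1 : 1 / μ ^ 2 ≤ 1 / μ := one_div_le_one_div_of_le hμ (le_self_pow₀ hμ1 two_ne_zero)
  have hi2 : 1 / μ ^ 3 ≤ 1 / μ := one_div_le_one_div_of_le hμ (le_self_pow₀ hμ1 three_ne_zero)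
  have hi : 0 < 1 / μ := by positivity
  have hi2' : 0 < 1 / μ ^ 2 := by positivity
  have hexp : (μ / 2 + 1 / 12) * ((1 - Real.exp (-μ)) / μ) ≤ 1 / 2 + 1 / 12 * (1 / μ) := by
    have : (μ / 2 + 1 / 12) * ((1 - Real.exp (-μ)) / μ) ≤ (μ / 2 + 1 / 12) * (1 / μ) := by
      gcongr
      linarith [Real.exp_pos (-μ)]
    refine this.trans_eq ?_
    field_simp
  have e2 : 1 / (2 * μ) * (μ + 1) = 1 / 2 + 1 / 2 * (1 / μ) := by field_simp
  have e3 : -(1 / (6 * μ ^ 2)) * (4 * μ + 1) = -(2 / 3 * (1 / μ)) - 1 / 6 * (1 / μ ^ 2) := by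
    field_simp
    ring
  have e4 : 1 / (3 * μ ^ 3) * (3 * μ ^ 2 + 11 * μ + 1)
      = 1 / μ + 11 / 3 * (1 / μ ^ 2) + 1 / 3 * (1 / μ ^ 3) := by
    field_simp
  have e1 : 1 / (2 * μ) = 1 / 2 * (1 / μ) := by field_simp
  rw [e2, e3, e4] at hU
  rw [e2, e3, e1] at hL
  rw [Real.norm_eq_abs, Real.norm_of_nonneg hi.le, hlog, abs_le]
  constructor <;> linarith
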